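/- For every real a⁺ ≥ 1, there exist constants c, C > 0 depending only on a⁺ such that for every integer N ≥ 2 the spectral gap λ of the Metropolis chain for π_{1,a⁺} on {−N,…,N} (i.e. with a⁻ = 1) satisfies c/(N² log N) ≤ λ ≤ C/(N² log N). -/

import Mathlib

open Finset

/-- The unnormalized density `F(x) = (1+|x|)^{a⁻}` for `x ≤ 0` and
`(1+|x|)^{a⁺}` for `x > 0` on `ℤ`. -/
noncomputable def metroF (am ap : ℝ) (x : ℤ) : ℝ :=
  if x ≤ 0 then ((1 + |x| : ℤ) : ℝ) ^ am else ((1 + |x| : ℤ) : ℝ) ^ ap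

/-- The probability measure on `{-N⁻,…,N⁺}` proportional to `metroF`. -/
noncomputable def metroPi (am ap : ℝ) (Nm Np : ℤ) (x : ℤ) : ℝ :=
  metroF am ap x / ∑ y ∈ Finset.Icc (-Nm) Np, metroF am ap y

/-- Dirichlet form of the Metropolis chain for `metroPi` based on
nearest-neighbor random walk on `{-N⁻,…,N⁺}`. -/
noncomputable def metroDirichlet (am ap : ℝ) (Nm Np : ℤ) (u : ℤ → ℝ) : ℝ :=
  ∑ x ∈ Finset.Icc (-Nm) (Np - 1),
    (u (x + 1) - u x) ^ 2 *
      (1 / 2 * min (metroPi am ap Nm Np x) (metroPi am ap Nm Np (x + 1)))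

/-- Variance with respect to `metroPi`. -/
noncomputable def metroVar (am ap : ℝ) (Nm Np : ℤ) (u : ℤ → ℝ) : ℝ :=
  ∑ x ∈ Finset.Icc (-Nm) Np,
    (u x - ∑ y ∈ Finset.Icc (-Nm) Np, u y * metroPi am ap Nm Np y) ^ 2 *
      metroPi am ap Nm Np x

/-- Spectral gap of the Metropolis chain:
`λ = inf { ℰ(u,u)/Var_π(u) : Var_π(u) ≠ 0 }`. -/
noncomputable def metroGap (am ap : ℝ) (Nm Np : ℤ) : ℝ :=
  sInf {r : ℝ | ∃ u : ℤ → ℝ, metroVar am ap Nm Np u ≠ 0 ∧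
    r = metroDirichlet am ap Nm Np u / metroVar am ap Nm Np u}

theorem metroF_of_nonpos (am ap : ℝ) {x : ℤ} (hx : x ≤ 0) :
    metroF am ap x = (1 - x : ℝ) ^ am := by
  simp [metroF, hx, abs_of_nonpos hx, sub_eq_add_neg]

theorem metroF_of_nonneg (am ap : ℝ) {x : ℤ} (hx : 0 ≤ x) :
    metroF am ap x = (1 + x : ℝ) ^ ap := by
  rcases hx.eq_or_lt with rfl | h
  · simp [metroF]
  · simp [metroF, h.not_ge, abs_of_nonneg hx]

theorem metroF_pos (am ap : ℝ) (x : ℤ) : 0 < metroF am ap x := by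
  have h : (0 : ℝ) < ((1 + |x| : ℤ) : ℝ) := by
    have := abs_nonneg x
    exact_mod_cast (by omega : 0 < 1 + |x|)
  unfold metroF
  split_ifs <;> exact Real.rpow_pos_of_pos h _

theorem sum_metroF_pos (am ap : ℝ) {N : ℤ} (hN : 0 ≤ N) :
    0 < ∑ y ∈ Icc (-N) N, metroF am ap y :=
  sum_pos (fun x _ => metroF_pos am ap x) ⟨0, by simp [hN]⟩

theorem metroDirichlet_eq_div (am ap : ℝ) {N : ℤ} (hN : 0 ≤ N) (u : ℤ → ℝ) :
    metroDirichlet am ap N N u =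
      (1 / 2 * ∑ x ∈ Icc (-N) (N - 1),
        (u (x + 1) - u x) ^ 2 * min (metroF am ap x) (metroF am ap (x + 1))) /
        ∑ y ∈ Icc (-N) N, metroF am ap y := by
  have hZ := sum_metroF_pos am ap hN
  unfold metroDirichlet metroPi
  rw [mul_sum, sum_div]
  refine sum_congr rfl fun x _ => ?_
  rw [min_div_div_right hZ.le]
  ring

theorem metroVar_eq_div (am ap : ℝ) (N : ℤ) (u : ℤ → ℝ) :
    metroVar am ap N N u =
      (∑ x ∈ Icc (-N) N, (u x - ∑ y ∈ Icc (-N) N, u y * metroPi am ap N N y) ^ 2 *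
        metroF am ap x) / ∑ y ∈ Icc (-N) N, metroF am ap y := by
  rw [metroVar, sum_div]
  refine sum_congr rfl fun x _ => ?_
  rw [mul_div_assoc, ← metroPi]

theorem metroVar_le_div (am ap : ℝ) {N : ℤ} (hN : 0 ≤ N) (u : ℤ → ℝ) (c : ℝ) :
    metroVar am ap N N u ≤ (∑ x ∈ Icc (-N) N, (u x - c) ^ 2 * metroF am ap x) /
      ∑ y ∈ Icc (-N) N, metroF am ap y := by
  have hZ := sum_metroF_pos am ap hN
  have hone : ∑ x ∈ Icc (-N) N, metroPi am ap N N x = 1 := by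
    simp only [metroPi, ← sum_div]
    exact div_self hZ.ne'
  have hR : (∑ x ∈ Icc (-N) N, (u x - c) ^ 2 * metroF am ap x) /
      ∑ y ∈ Icc (-N) N, metroF am ap y =
      ∑ x ∈ Icc (-N) N, (u x - c) ^ 2 * metroPi am ap N N x := by
    rw [sum_div]
    refine sum_congr rfl fun x _ => ?_
    rw [mul_div_assoc, ← metroPi]
  rw [hR, metroVar]
  set m := ∑ y ∈ Icc (-N) N, u y * metroPi am ap N N y with hm
  have key : ∑ x ∈ Icc (-N) N, (u x - c) ^ 2 * metroPi am ap N N x =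
      ∑ x ∈ Icc (-N) N, (u x - m) ^ 2 * metroPi am ap N N x +
        (2 * (m - c) * m + (c ^ 2 - m ^ 2) * 1) := by
    conv_rhs => rw [← hone]; enter [2, 1, 2]; rw [hm]
    rw [mul_sum, mul_sum, ← sum_add_distrib, ← sum_add_distrib]
    refine sum_congr rfl fun x _ => ?_
    ring
  nlinarith [sq_nonneg (m - c)]

/-- A bound for the resistance of the edge `{y, y + 1}` when `a⁻ = 1 ≤ a⁺`. -/
noncomputable def edgeResistance (y : ℤ) : ℝ :=
  if 0 ≤ y then ((1 + y : ℝ))⁻¹ else (-y : ℝ)⁻¹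

theorem edgeResistance_nonneg (y : ℤ) : 0 ≤ edgeResistance y := by
  unfold edgeResistance
  split_ifs with h
  · have : (0 : ℝ) ≤ y := by exact_mod_cast h
    positivity
  · have : (y : ℝ) < 0 := by exact_mod_cast not_le.mp h
    exact inv_nonneg.mpr (by linarith)

theorem min_metroF_of_nonneg (am : ℝ) {ap : ℝ} (hap : 0 ≤ ap) {y : ℤ} (hy : 0 ≤ y) :
    min (metroF am ap y) (metroF am ap (y + 1)) = (1 + y : ℝ) ^ ap := by
  have hy' : (0 : ℝ) ≤ y := by exact_mod_cast hy
  rw [metroF_of_nonneg _ _ hy, metroF_of_nonneg _ _ (by omega), min_eq_left]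
  exact Real.rpow_le_rpow (by positivity) (by push_cast; linarith) hap

theorem min_metroF_of_neg (ap : ℝ) {y : ℤ} (hy : y < 0) :
    min (metroF 1 ap y) (metroF 1 ap (y + 1)) = -y := by
  rw [metroF_of_nonpos _ _ hy.le, metroF_of_nonpos _ _ (by omega), Real.rpow_one,
    Real.rpow_one, min_eq_right (by push_cast; linarith)]
  push_cast
  ring

theorem metroF_div_min_le {ap : ℝ} (hap : 1 ≤ ap) {x y : ℤ} (hxy : x ≤ y) :
    metroF 1 ap x / min (metroF 1 ap y) (metroF 1 ap (y + 1)) ≤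
      (1 + |(x : ℝ)|) * edgeResistance y := by
  have hxy' : (x : ℝ) ≤ y := by exact_mod_cast hxy
  unfold edgeResistance
  split_ifs with hy
  · rw [min_metroF_of_nonneg _ (by linarith) hy]
    have hy' : (0 : ℝ) ≤ y := by exact_mod_cast hy
    rcases le_total 0 x with hx | hx
    · have hx' : (0 : ℝ) ≤ x := by exact_mod_cast hx
      rw [metroF_of_nonneg _ _ hx, abs_of_nonneg hx',
        ← Real.div_rpow (by positivity) (by positivity), ← div_eq_mul_inv]
      exact Real.rpow_le_self_of_le_one (by positivity)
        ((div_le_one (by positivity)).mpr (by linarith)) hap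
    · have hx' : (x : ℝ) ≤ 0 := by exact_mod_cast hx
      rw [metroF_of_nonpos _ _ hx, abs_of_nonpos hx', Real.rpow_one, ← sub_eq_add_neg,
        ← div_eq_mul_inv]
      refine div_le_div_of_nonneg_left (by linarith) (by positivity) ?_
      exact Real.self_le_rpow_of_one_le (by linarith) hap
  · have hx : x ≤ 0 := by omega
    have hx' : (x : ℝ) ≤ 0 := by exact_mod_cast hx
    rw [min_metroF_of_neg _ (not_le.mp hy), metroF_of_nonpos _ _ hx, abs_of_nonpos hx',
      Real.rpow_one, ← sub_eq_add_neg, ← div_eq_mul_inv]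

theorem sum_Ico_sub_int (u : ℤ → ℝ) {x N : ℤ} (h : x ≤ N) :
    ∑ y ∈ Ico x N, (u (y + 1) - u y) = u N - u x := by
  induction N, h using Int.leInduction with
  | base => simp
  | succ n hn ih =>
    have : Ico x (n + 1) = insert n (Ico x n) := by
      ext z
      simp only [mem_Ico, mem_insert]
      omega
    rw [this, sum_insert (by simp), ih]
    ring

theorem sum_Icc_neg_sub_one (f : ℤ → ℝ) (n : ℕ) :
    ∑ y ∈ Icc (-(n : ℤ)) (n - 1), f y = ∑ k ∈ range n, (f k + f (-1 - k)) := by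
  induction n with
  | zero => simp
  | succ n ih =>
    have : Icc (-((n + 1 : ℕ) : ℤ)) ((n + 1 : ℕ) - 1) =
        insert (n : ℤ) (insert (-1 - n : ℤ) (Icc (-(n : ℤ)) (n - 1))) := by
      ext z
      simp only [mem_Icc, mem_insert]
      omega
    rw [this, sum_insert (by simp only [mem_Icc, mem_insert]; omega),
      sum_insert (by simp only [mem_Icc]; omega), ih, sum_range_succ]
    ring

theorem sum_Icc_neg_self (f : ℤ → ℝ) (n : ℕ) :
    ∑ y ∈ Icc (-(n : ℤ)) n, f y = f 0 + ∑ k ∈ range n, (f (k + 1) + f (-(k + 1))) := by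
  induction n with
  | zero => simp
  | succ n ih =>
    have : Icc (-((n + 1 : ℕ) : ℤ)) ((n + 1 : ℕ)) =
        insert (n + 1 : ℤ) (insert (-(n + 1) : ℤ) (Icc (-(n : ℤ)) n)) := by
      ext z
      simp only [mem_Icc, mem_insert]
      omega
    rw [this, sum_insert (by simp only [mem_Icc, mem_insert]; omega),
      sum_insert (by simp only [mem_Icc]; omega), ih, sum_range_succ]
    ring

theorem sum_range_inv_le_log {n : ℕ} (hn : 2 ≤ n) :
    ∑ k ∈ range n, ((1 + k : ℝ))⁻¹ ≤ 5 / 2 * Real.log n := by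
  have h := harmonic_le_one_add_log n
  have h2 : Real.log 2 ≤ Real.log n := Real.log_le_log (by norm_num) (by exact_mod_cast hn)
  have h3 := Real.log_two_gt_d9
  have h4 : ((harmonic n : ℚ) : ℝ) = ∑ k ∈ range n, ((1 + k : ℝ))⁻¹ := by
    rw [harmonic]
    push_cast
    exact sum_congr rfl fun k _ => by rw [add_comm]
  linarith

theorem sum_edgeResistance_le {n : ℕ} (hn : 2 ≤ n) :
    ∑ y ∈ Icc (-(n : ℤ)) (n - 1), edgeResistance y ≤ 5 * Real.log n := by
  have h := sum_range_inv_le_log hn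
  rw [sum_Icc_neg_sub_one]
  have : ∀ k ∈ range n, edgeResistance k + edgeResistance (-1 - k) = 2 * ((1 + k : ℝ))⁻¹ := by
    intro k _
    rw [edgeResistance, edgeResistance, if_pos (by omega), if_neg (by omega)]
    push_cast
    ring
  rw [sum_congr rfl this, ← mul_sum]
  linarith

theorem sq_sub_mul_metroF_le {ap : ℝ} (hap : 1 ≤ ap) {n : ℕ} (hn : 2 ≤ n) (u : ℤ → ℝ)
    {x : ℤ} (hx : x ∈ Icc (-(n : ℤ)) n) :
    (u x - u n) ^ 2 * metroF 1 ap x ≤ (1 + n) * (5 * Real.log n) *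
      ∑ y ∈ Icc (-(n : ℤ)) (n - 1),
        (u (y + 1) - u y) ^ 2 * min (metroF 1 ap y) (metroF 1 ap (y + 1)) := by
  rw [mem_Icc] at hx
  set w : ℤ → ℝ := fun y => min (metroF 1 ap y) (metroF 1 ap (y + 1))
  have hw0 : ∀ y, 0 < w y := fun y => lt_min (metroF_pos _ _ _) (metroF_pos _ _ _)
  have hsub : Ico x n ⊆ Icc (-(n : ℤ)) (n - 1) := by
    intro y
    simp only [mem_Ico, mem_Icc]
    omega
  have habs : |(x : ℝ)| ≤ n := by
    rw [abs_le]
    exact ⟨by exact_mod_cast hx.1, by exact_mod_cast hx.2⟩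
  have hcs : (u x - u n) ^ 2 ≤
      (∑ y ∈ Ico x n, 1 / w y) * ∑ y ∈ Ico x n, (u (y + 1) - u y) ^ 2 * w y := by
    rw [← neg_sub, neg_sq, ← sum_Ico_sub_int u hx.2]
    refine sum_sq_le_sum_mul_sum_of_sq_le_mul _ (fun y _ => ?_) (fun y _ => ?_) (fun y _ => ?_)
    · exact (one_div_pos.mpr (hw0 y)).le
    · exact mul_nonneg (sq_nonneg _) (hw0 y).le
    · rw [one_div, mul_left_comm, inv_mul_cancel₀ (hw0 y).ne', mul_one]
  have hres : metroF 1 ap x * ∑ y ∈ Ico x n, 1 / w y ≤ (1 + n) * (5 * Real.log n) := by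
    calc metroF 1 ap x * ∑ y ∈ Ico x n, 1 / w y
        ≤ ∑ y ∈ Ico x n, (1 + |(x : ℝ)|) * edgeResistance y := by
          rw [mul_sum]
          refine sum_le_sum fun y hy => ?_
          rw [mul_one_div]
          exact metroF_div_min_le hap (mem_Ico.mp hy).1
      _ ≤ (1 + n) * ∑ y ∈ Icc (-(n : ℤ)) (n - 1), edgeResistance y := by
          rw [← mul_sum]
          refine mul_le_mul (by linarith) ?_ (sum_nonneg fun y _ => edgeResistance_nonneg y)
            (by positivity)
          exact sum_le_sum_of_subset_of_nonneg hsub fun y _ _ => edgeResistance_nonneg y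
      _ ≤ _ := mul_le_mul_of_nonneg_left (sum_edgeResistance_le hn) (by positivity)
  have hE : ∑ y ∈ Ico x n, (u (y + 1) - u y) ^ 2 * w y ≤
      ∑ y ∈ Icc (-(n : ℤ)) (n - 1), (u (y + 1) - u y) ^ 2 * w y :=
    sum_le_sum_of_subset_of_nonneg hsub fun y _ _ => mul_nonneg (sq_nonneg _) (hw0 y).le
  have hE0 : 0 ≤ ∑ y ∈ Ico x n, (u (y + 1) - u y) ^ 2 * w y :=
    sum_nonneg fun y _ => mul_nonneg (sq_nonneg _) (hw0 y).le
  calc (u x - u n) ^ 2 * metroF 1 ap x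
      ≤ ((∑ y ∈ Ico x n, 1 / w y) * ∑ y ∈ Ico x n, (u (y + 1) - u y) ^ 2 * w y) *
          metroF 1 ap x := mul_le_mul_of_nonneg_right hcs (metroF_pos _ _ _).le
    _ = (metroF 1 ap x * ∑ y ∈ Ico x n, 1 / w y) *
          ∑ y ∈ Ico x n, (u (y + 1) - u y) ^ 2 * w y := by ring
    _ ≤ _ := mul_le_mul hres hE hE0 (mul_nonneg (by positivity)
          (mul_nonneg (by norm_num) (Real.log_natCast_nonneg n)))

/-- The Poincaré inequality with constant of order `N² log N`. -/
theorem metroVar_le_mul_metroDirichlet {ap : ℝ} (hap : 1 ≤ ap) {n : ℕ} (hn : 2 ≤ n)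
    (u : ℤ → ℝ) :
    metroVar 1 ap n n u ≤ 40 * ((n : ℝ) ^ 2 * Real.log n) * metroDirichlet 1 ap n n u := by
  have hn0 : (0 : ℤ) ≤ n := by positivity
  have hn2 : (2 : ℝ) ≤ n := by exact_mod_cast hn
  have hZ := sum_metroF_pos 1 ap hn0
  refine (metroVar_le_div 1 ap hn0 u (u n)).trans ?_
  rw [metroDirichlet_eq_div 1 ap hn0, ← mul_div_assoc]
  refine div_le_div_of_nonneg_right ?_ hZ.le
  refine (sum_le_card_nsmul _ _ _ fun x hx => sq_sub_mul_metroF_le hap hn u hx).trans ?_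
  set E := ∑ y ∈ Icc (-(n : ℤ)) (n - 1),
    (u (y + 1) - u y) ^ 2 * min (metroF 1 ap y) (metroF 1 ap (y + 1))
  have hE0 : 0 ≤ E := sum_nonneg fun y _ => mul_nonneg (sq_nonneg _)
    (lt_min (metroF_pos _ _ _) (metroF_pos _ _ _)).le
  have hcard : (#(Icc (-(n : ℤ)) n) : ℝ) = 2 * n + 1 := by
    rw [Int.card_Icc]
    have : ((n : ℤ) + 1 - -n).toNat = 2 * n + 1 := by omega
    rw [this]
    push_cast
    ring
  rw [nsmul_eq_mul, hcard]
  have hLE : 0 ≤ Real.log n * E := mul_nonneg (Real.log_natCast_nonneg n) hE0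
  have : (2 * (n : ℝ) + 1) * (1 + n) ≤ 4 * n ^ 2 := by nlinarith
  nlinarith [mul_le_mul_of_nonneg_right this hLE]

/-- A logarithmic test function, supported on the negative half-line. -/
noncomputable def logTest (x : ℤ) : ℝ := if x ≤ 0 then Real.log (1 - x) else 0

theorem metroDirichlet_logTest_le (ap : ℝ) {n : ℕ} (hn : 2 ≤ n) :
    metroDirichlet 1 ap n n logTest ≤
      (5 / 4 * Real.log n) / ∑ y ∈ Icc (-(n : ℤ)) n, metroF 1 ap y := by
  have hn0 : (0 : ℤ) ≤ n := by positivity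
  have hZ := sum_metroF_pos 1 ap hn0
  rw [metroDirichlet_eq_div 1 ap hn0]
  refine div_le_div_of_nonneg_right ?_ hZ.le
  rw [sum_Icc_neg_sub_one]
  suffices h : ∀ k ∈ range n,
      (logTest (k + 1) - logTest k) ^ 2 * min (metroF 1 ap k) (metroF 1 ap (k + 1)) +
      (logTest (-1 - k + 1) - logTest (-1 - k)) ^ 2 *
        min (metroF 1 ap (-1 - k)) (metroF 1 ap (-1 - k + 1)) ≤ ((1 + k : ℝ))⁻¹ by
    linarith [sum_le_sum h, sum_range_inv_le_log hn]
  intro k _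
  have hk : (0 : ℝ) ≤ k := k.cast_nonneg
  have h1 : logTest (k + 1) = 0 := by rw [logTest, if_neg (by omega)]
  have h2 : logTest k = 0 := by
    rcases k.eq_zero_or_pos with rfl | h
    · simp [logTest]
    · rw [logTest, if_neg (by omega)]
  have h3 : logTest (-1 - k + 1) = Real.log (1 + k) := by
    rw [logTest, if_pos (by omega)]
    push_cast
    ring_nf
  have h4 : logTest (-1 - k) = Real.log (2 + k) := by
    rw [logTest, if_pos (by omega)]
    push_cast
    ring_nf
  rw [h1, h2, h3, h4, min_metroF_of_neg ap (by omega : (-1 - k : ℤ) < 0)]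
  have h5 : Real.log (2 + k) - Real.log (1 + k) ≤ (1 + k : ℝ)⁻¹ := by
    rw [← Real.log_div (by positivity) (by positivity)]
    refine (Real.log_le_sub_one_of_pos (by positivity)).trans (le_of_eq ?_)
    field_simp
    ring
  have h6 : 0 ≤ Real.log (2 + k) - Real.log (1 + k) :=
    sub_nonneg.mpr (Real.log_le_log (by positivity) (by linarith))
  have h7 : (Real.log (1 + k) - Real.log (2 + k)) ^ 2 ≤ ((1 + k : ℝ)⁻¹) ^ 2 := by
    rw [← neg_sub, neg_sq]
    exact pow_le_pow_left₀ h6 h5 2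
  have h8 : ((1 + k : ℝ)⁻¹) ^ 2 * (1 + k) = (1 + k : ℝ)⁻¹ := by
    field_simp
  have h9 := mul_le_mul_of_nonneg_right h7 (by positivity : (0 : ℝ) ≤ 1 + k)
  push_cast
  linarith

theorem le_metroVar_logTest {ap : ℝ} (hap : 1 ≤ ap) {n : ℕ} (hn : 2 ≤ n) :
    ((n : ℝ) ^ 2 * Real.log n ^ 2 / 32) / ∑ y ∈ Icc (-(n : ℤ)) n, metroF 1 ap y ≤
      metroVar 1 ap n n logTest := by
  have hn2 : (2 : ℝ) ≤ n := by exact_mod_cast hn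
  have hZ := sum_metroF_pos 1 ap (by positivity : (0 : ℤ) ≤ n)
  rw [metroVar_eq_div]
  refine div_le_div_of_nonneg_right ?_ hZ.le
  set c := ∑ y ∈ Icc (-(n : ℤ)) n, logTest y * metroPi 1 ap n n y
  rw [sum_Icc_neg_self]
  set f : ℕ → ℝ := fun k => (logTest (k + 1) - c) ^ 2 * metroF 1 ap (k + 1) +
    (logTest (-(k + 1)) - c) ^ 2 * metroF 1 ap (-(k + 1)) with hf
  have hf0 : ∀ k, 0 ≤ f k := fun k => add_nonneg
    (mul_nonneg (sq_nonneg _) (metroF_pos _ _ _).le)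
    (mul_nonneg (sq_nonneg _) (metroF_pos _ _ _).le)
  have hfk : ∀ k ∈ Ico (n / 2) n, (n : ℝ) * Real.log n ^ 2 / 16 ≤ f k := by
    intro k hk
    have hk2 : (n : ℝ) ≤ 2 * k + 1 := by
      have := (mem_Ico.mp hk).1
      exact_mod_cast (by omega : n ≤ 2 * k + 1)
    have hk0 : (0 : ℝ) ≤ k := k.cast_nonneg
    have h1 : logTest (k + 1) = 0 := by rw [logTest, if_neg (by omega)]
    have h2 : logTest (-(k + 1)) = Real.log (2 + k) := by
      rw [logTest, if_pos (by omega)]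
      push_cast
      ring_nf
    have h3 : metroF 1 ap (-(k + 1)) = 2 + k := by
      rw [metroF_of_nonpos _ _ (by omega), Real.rpow_one]
      push_cast
      ring
    have h4 : (2 + k : ℝ) ≤ metroF 1 ap (k + 1) := by
      rw [metroF_of_nonneg _ _ (by omega)]
      push_cast
      rw [show (1 + (k + 1) : ℝ) = 2 + k by ring]
      exact Real.self_le_rpow_of_one_le (by linarith) hap
    have h5 : Real.log n ≤ 2 * Real.log (2 + k) := by
      have := Real.log_pow (2 + k : ℝ) 2
      push_cast at this
      rw [← this]
      exact Real.log_le_log (by positivity) (by nlinarith)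
    have h6 : Real.log n ^ 2 ≤ 4 * Real.log (2 + k) ^ 2 := by
      have := pow_le_pow_left₀ (Real.log_natCast_nonneg n) h5 2
      linarith
    have h7 : c ^ 2 * (2 + k) ≤ c ^ 2 * metroF 1 ap (k + 1) :=
      mul_le_mul_of_nonneg_left h4 (sq_nonneg c)
    have h8 : Real.log (2 + k) ^ 2 / 2 * (2 + k) ≤
        (c ^ 2 + (Real.log (2 + k) - c) ^ 2) * (2 + k) :=
      mul_le_mul_of_nonneg_right
        (by nlinarith [sq_nonneg (Real.log (2 + k) - 2 * c)]) (by positivity)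
    have h9 : (n : ℝ) / 2 * (Real.log n ^ 2 / 8) ≤ (2 + k) * (Real.log (2 + k) ^ 2 / 2) :=
      mul_le_mul (by linarith) (by linarith) (by positivity) (by positivity)
    simp only [hf, h1, h2, h3]
    nlinarith
  have hsum : (n : ℝ) ^ 2 * Real.log n ^ 2 / 32 ≤ ∑ k ∈ range n, f k := by
    have hcard : (n : ℝ) / 2 ≤ #(Ico (n / 2) n) := by
      rw [Nat.card_Ico, div_le_iff₀ (by norm_num)]
      exact_mod_cast (by omega : n ≤ (n - n / 2) * 2)
    calc (n : ℝ) ^ 2 * Real.log n ^ 2 / 32 = n / 2 * (n * Real.log n ^ 2 / 16) := by ring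
      _ ≤ #(Ico (n / 2) n) * (n * Real.log n ^ 2 / 16) :=
        mul_le_mul_of_nonneg_right hcard (by positivity)
      _ ≤ ∑ k ∈ Ico (n / 2) n, f k := by
        rw [← nsmul_eq_mul]
        exact card_nsmul_le_sum _ _ _ hfk
      _ ≤ ∑ k ∈ range n, f k := by
        refine sum_le_sum_of_subset_of_nonneg (fun k hk => ?_) fun k _ _ => hf0 k
        exact mem_range.mpr (mem_Ico.mp hk).2
  exact hsum.trans (le_add_of_nonneg_left (mul_nonneg (sq_nonneg _) (metroF_pos _ _ _).le))

/-- for `a⁻ = 1 ≤ a⁺`, the spectral gap on `{-N,…,N}` is of order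
`1/(N² log N)`. -/
theorem gap_symmetric_critical (ap : ℝ) (hap : 1 ≤ ap) :
    ∃ c C : ℝ, 0 < c ∧ 0 < C ∧ ∀ N : ℤ, 2 ≤ N →
      c / ((N : ℝ) ^ 2 * Real.log N) ≤ metroGap 1 ap N N ∧
      metroGap 1 ap N N ≤ C / ((N : ℝ) ^ 2 * Real.log N) := by
  refine ⟨1 / 40, 40, by norm_num, by norm_num, fun N hN => ?_⟩
  lift N to ℕ using by omega
  rename' N => n
  have hn : 2 ≤ n := by exact_mod_cast hN
  have hn2 : (2 : ℝ) ≤ n := by exact_mod_cast hn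
  have hlog : 0 < Real.log n := Real.log_pos (by linarith)
  have hZ := sum_metroF_pos 1 ap (by positivity : (0 : ℤ) ≤ n)
  rw [Int.cast_natCast]
  have hlower : ∀ r ∈ {r : ℝ | ∃ u : ℤ → ℝ, metroVar 1 ap n n u ≠ 0 ∧
      r = metroDirichlet 1 ap n n u / metroVar 1 ap n n u},
      1 / 40 / ((n : ℝ) ^ 2 * Real.log n) ≤ r := by
    rintro r ⟨u, hu, rfl⟩
    have hpos : 0 < metroVar 1 ap n n u := by
      refine lt_of_le_of_ne ?_ hu.symm
      rw [metroVar_eq_div]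
      exact div_nonneg (sum_nonneg fun x _ => mul_nonneg (sq_nonneg _) (metroF_pos _ _ _).le)
        hZ.le
    rw [div_div, div_le_div_iff₀ (by positivity) hpos]
    linarith [metroVar_le_mul_metroDirichlet hap hn u]
  have hvar := le_metroVar_logTest hap hn
  have hvar0 : 0 < metroVar 1 ap n n logTest := lt_of_lt_of_le (by positivity) hvar
  refine ⟨le_csInf ⟨_, logTest, hvar0.ne', rfl⟩ hlower,
    (csInf_le ⟨_, hlower⟩ ⟨logTest, hvar0.ne', rfl⟩).trans ?_⟩
  calc metroDirichlet 1 ap n n logTest / metroVar 1 ap n n logTest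
      ≤ ((5 / 4 * Real.log n) / ∑ y ∈ Icc (-(n : ℤ)) n, metroF 1 ap y) /
        (((n : ℝ) ^ 2 * Real.log n ^ 2 / 32) / ∑ y ∈ Icc (-(n : ℤ)) n, metroF 1 ap y) :=
        div_le_div₀ (by positivity) (metroDirichlet_logTest_le ap hn) (by positivity) hvar
    _ = 40 / ((n : ℝ) ^ 2 * Real.log n) := by
        rw [div_div_div_cancel_right₀ hZ.ne']
        field_simp
        norm_num
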